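/- (Viro: signature is a complete invariant for five lines) Two configurations L and L′ of 5 pairwise skew lines in RP³ are deformation equivalent if and only if sgn(L) = sgn(L′). -/

import Mathlib

open Submodule

abbrev V4 : Type := Fin 4 → ℝ

abbrev PLine : Type := Submodule ℝ V4

def IsLine (P : PLine) : Prop := Module.finrank ℝ P = 2

def Skew (P Q : PLine) : Prop := IsLine P ∧ IsLine Q ∧ P ⊓ Q = ⊥

def PairwiseSkew {n : ℕ} (L : Fin n → PLine) : Prop :=
  ∀ i j : Fin n, i ≠ j → Skew (L i) (L j)

noncomputable def det2 (a b c d : V4) : ℝ := Matrix.det (Matrix.of ![a, b, c, d])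

open Classical in
noncomputable def lk (P Q R : PLine) : ℝ :=
  if h : ∃ v : Fin 6 → V4,
      P = span ℝ {v 0, v 1} ∧ Q = span ℝ {v 2, v 3} ∧ R = span ℝ {v 4, v 5} then
    Real.sign (det2 (h.choose 0) (h.choose 1) (h.choose 2) (h.choose 3) *
      det2 (h.choose 0) (h.choose 1) (h.choose 4) (h.choose 5) *
      det2 (h.choose 2) (h.choose 3) (h.choose 4) (h.choose 5))
  else 0

noncomputable def sgnOf {n : ℕ} (L : Fin n → PLine) : ℝ :=
  ∑ i : Fin n, ∑ j : Fin n, ∑ k : Fin n,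
    if i < j ∧ j < k then lk (L i) (L j) (L k) else 0

def ContinuousLineFamily (L : ℝ → PLine) : Prop :=
  ∃ v w : ℝ → V4, ContinuousOn v (Set.Icc 0 1) ∧ ContinuousOn w (Set.Icc 0 1) ∧
    ∀ t ∈ Set.Icc (0:ℝ) 1, L t = span ℝ {v t, w t}

def Deformation {n : ℕ} (L L' : Fin n → PLine) : Prop :=
  ∃ F : ℝ → Fin n → PLine,
    (∀ i, ContinuousLineFamily (fun t => F t i)) ∧
    (∀ t ∈ Set.Icc (0:ℝ) 1, PairwiseSkew (F t)) ∧
    F 0 = L ∧ F 1 = L'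

def DeformEquiv {n : ℕ} (L L' : Fin n → PLine) : Prop :=
  ∃ π π' : Equiv.Perm (Fin n), Deformation (L ∘ π) (L' ∘ π')

def IsMirror {n : ℕ} (L L' : Fin n → PLine) : Prop :=
  ∃ A : V4 →ₗ[ℝ] V4, LinearMap.det A < 0 ∧ ∀ i, L' i = (L i).map A

def CoarseDeformEquiv {n : ℕ} (L L' : Fin n → PLine) : Prop :=
  DeformEquiv L L' ∨ ∃ M : Fin n → PLine, IsMirror L' M ∧ DeformEquiv L M

noncomputable def joinConfig {n : ℕ} (σ : Equiv.Perm (Fin n)) : Fin n → PLine :=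
  fun i => span ℝ {![1, (i.val : ℝ) + 1, 0, 0], ![0, 0, ((σ i).val : ℝ) + 1, 1]}

def IsSchlafliSix (L : Fin 6 → PLine) : Prop :=
  PairwiseSkew L ∧
  ∃ F : MvPolynomial (Fin 4) ℝ,
    F ≠ 0 ∧ F.IsHomogeneous 3 ∧
    (∀ i : Fin 6, ∀ x ∈ L i, MvPolynomial.eval x F = 0) ∧
    (∀ z : Fin 4 → ℂ, z ≠ 0 →
      MvPolynomial.eval z (MvPolynomial.map (algebraMap ℝ ℂ) F) = 0 →
      ∃ j : Fin 4, MvPolynomial.eval z (MvPolynomial.map (algebraMap ℝ ℂ) (MvPolynomial.pderiv j F)) ≠ 0)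

def Reducible {n : ℕ} (L : Fin n → PLine) : Prop :=
  ∃ i j : Fin n, i ≠ j ∧ ∃ F : ℝ → Fin n → PLine,
    (∀ k, ContinuousLineFamily (fun t => F t k)) ∧
    F 0 = L ∧
    (∀ t ∈ Set.Ico (0:ℝ) 1, PairwiseSkew (F t)) ∧
    F 1 i = F 1 j ∧
    (∀ k l : Fin n, k ≠ l → ¬(k = i ∧ l = j) → ¬(k = j ∧ l = i) → Skew (F 1 k) (F 1 l))

/-- Two vectors of `ℝ⁴`, thought of as a frame of the line they span. -/
abbrev Frame : Type := V4 × V4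

/-- The line spanned by a frame. -/
def lineOf (p : Frame) : PLine := span ℝ {p.1, p.2}

/-- The determinant of a pair of frames. -/
noncomputable def frameDet (p q : Frame) : ℝ := det2 p.1 p.2 q.1 q.2

/-- Plücker coordinates of a frame. -/
def plucker (p : Frame) (i j : Fin 4) : ℝ := p.1 i * p.2 j - p.1 j * p.2 i

/-- The change of frame with coefficient matrix `!![a, b; c, d]`. -/
def reframe (g : Fin 4 → ℝ) (p : Frame) : Frame :=
  (g 0 • p.1 + g 1 • p.2, g 2 • p.1 + g 3 • p.2)

/-- The determinant of the coefficients of a change of frame. -/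
def coeffDet (g : Fin 4 → ℝ) : ℝ := g 0 * g 3 - g 1 * g 2

lemma det2_eq (a b c d : V4) : det2 a b c d =
    (a 0 * b 1 - a 1 * b 0) * (c 2 * d 3 - c 3 * d 2)
    - (a 0 * b 2 - a 2 * b 0) * (c 1 * d 3 - c 3 * d 1)
    + (a 0 * b 3 - a 3 * b 0) * (c 1 * d 2 - c 2 * d 1)
    + (a 1 * b 2 - a 2 * b 1) * (c 0 * d 3 - c 3 * d 0)
    - (a 1 * b 3 - a 3 * b 1) * (c 0 * d 2 - c 2 * d 0)
    + (a 2 * b 3 - a 3 * b 2) * (c 0 * d 1 - c 1 * d 0) := by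
  rw [det2, Matrix.det_succ_row_zero]
  simp [Fin.sum_univ_succ, Matrix.det_fin_three, Fin.succAbove]
  ring

lemma frameDet_eq (p q : Frame) : frameDet p q =
    plucker p 0 1 * plucker q 2 3 - plucker p 0 2 * plucker q 1 3
    + plucker p 0 3 * plucker q 1 2 + plucker p 1 2 * plucker q 0 3
    - plucker p 1 3 * plucker q 0 2 + plucker p 2 3 * plucker q 0 1 := by
  rw [frameDet, det2_eq]; rfl

lemma frameDet_comm (p q : Frame) : frameDet p q = frameDet q p := by
  rw [frameDet_eq, frameDet_eq]; ring

lemma plucker_reframe (g : Fin 4 → ℝ) (p : Frame) (i j : Fin 4) :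
    plucker (reframe g p) i j = coeffDet g * plucker p i j := by
  simp [plucker, reframe, coeffDet]; ring

lemma frameDet_reframe (g h : Fin 4 → ℝ) (p q : Frame) :
    frameDet (reframe g p) (reframe h q) = coeffDet g * coeffDet h * frameDet p q := by
  simp only [frameDet_eq, plucker_reframe]; ring

lemma exists_reframe_of_lineOf_le {p q : Frame} (h : lineOf p ≤ lineOf q) :
    ∃ g, p = reframe g q := by
  have h1 : p.1 ∈ lineOf q := h (subset_span (by simp))
  have h2 : p.2 ∈ lineOf q := h (subset_span (by simp))
  obtain ⟨a, b, hab⟩ := mem_span_pair.1 h1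
  obtain ⟨c, d, hcd⟩ := mem_span_pair.1 h2
  exact ⟨![a, b, c, d], Prod.ext (by simp [reframe, hab]) (by simp [reframe, hcd])⟩

lemma lineOf_reframe_le (g : Fin 4 → ℝ) (p : Frame) : lineOf (reframe g p) ≤ lineOf p := by
  refine span_le.2 ?_
  rintro x (rfl | rfl)
  · exact mem_span_pair.2 ⟨_, _, rfl⟩
  · exact mem_span_pair.2 ⟨_, _, rfl⟩

lemma lineOf_reframe {g : Fin 4 → ℝ} (hg : coeffDet g ≠ 0) (p : Frame) :
    lineOf (reframe g p) = lineOf p := by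
  refine le_antisymm (lineOf_reframe_le g p) ?_
  have key : p = reframe ![g 3 / coeffDet g, -g 1 / coeffDet g, -g 2 / coeffDet g,
      g 0 / coeffDet g] (reframe g p) := by
    refine Prod.ext ?_ ?_ <;> ext i <;> simp [reframe] <;> field_simp <;>
      simp [coeffDet] <;> ring
  conv_lhs => rw [key]
  exact lineOf_reframe_le _ _

lemma linearIndependent_of_frameDet_ne_zero {p q : Frame} (h : frameDet p q ≠ 0) :
    LinearIndependent ℝ ![p.1, p.2, q.1, q.2] :=
  Matrix.linearIndependent_rows_of_det_ne_zero h

lemma isLine_lineOf_iff (p : Frame) :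
    IsLine (lineOf p) ↔ LinearIndependent ℝ ![p.1, p.2] := by
  rw [linearIndependent_iff_card_eq_finrank_span]
  have hrange : Set.range ![p.1, p.2] = {p.1, p.2} := by
    ext v
    simp [or_comm]
  rw [Set.finrank, hrange, Fintype.card_fin, eq_comm]
  rfl

lemma isLine_lineOf {p q : Frame} (h : frameDet p q ≠ 0) : IsLine (lineOf p) := by
  rw [isLine_lineOf_iff]
  have := (linearIndependent_of_frameDet_ne_zero h).comp ![0, 1] (by decide)
  convert this using 1
  ext i; fin_cases i <;> rfl

lemma skew_lineOf_iff (p q : Frame) : Skew (lineOf p) (lineOf q) ↔ frameDet p q ≠ 0 := by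
  constructor
  · rintro ⟨hp, hq, hpq⟩ h0
    obtain ⟨c, hc0, hc⟩ := Matrix.exists_vecMul_eq_zero_iff.2 h0
    rw [isLine_lineOf_iff, LinearIndependent.pair_iff] at hp hq
    have hc' : c 0 • p.1 + c 1 • p.2 = -(c 2 • q.1 + c 3 • q.2) := by
      rw [eq_neg_iff_add_eq_zero]
      ext i
      have := congrFun hc i
      simpa [Matrix.vecMul, dotProduct, Fin.sum_univ_succ, add_assoc] using this
    have hmem : c 0 • p.1 + c 1 • p.2 ∈ lineOf p ⊓ lineOf q :=
      ⟨mem_span_pair.2 ⟨_, _, rfl⟩, hc' ▸ neg_mem (mem_span_pair.2 ⟨_, _, rfl⟩)⟩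
    rw [hpq, mem_bot] at hmem
    obtain ⟨h1, h2⟩ := hp _ _ hmem
    rw [hmem, eq_comm, neg_eq_zero] at hc'
    obtain ⟨h3, h4⟩ := hq _ _ hc'
    exact hc0 (by ext i; fin_cases i <;> assumption)
  · intro h
    refine ⟨isLine_lineOf h, isLine_lineOf (frameDet_comm p q ▸ h), ?_⟩
    have hd := (linearIndependent_of_frameDet_ne_zero h).disjoint_span_image
      (s := {0, 1}) (t := {2, 3}) (by simp [Set.disjoint_left])
    rw [disjoint_iff] at hd
    simpa [Set.image_pair, lineOf] using hd

lemma exists_lineOf {P : PLine} (h : IsLine P) : ∃ p : Frame, P = lineOf p := by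
  have : Module.Finite ℝ P := inferInstance
  let b := Module.finBasisOfFinrankEq ℝ P h
  refine ⟨(b 0, b 1), ?_⟩
  have := congrArg (Submodule.map P.subtype) b.span_eq
  rw [Submodule.map_span, Submodule.map_top, range_subtype] at this
  refine this.symm.trans ?_
  rw [lineOf]
  congr 1
  ext x
  simp [Fin.exists_fin_two, eq_comm]

lemma sign_sq_mul {c : ℝ} (hc : c ≠ 0) (x : ℝ) : Real.sign (c ^ 2 * x) = Real.sign x := by
  have hc2 : 0 < c ^ 2 := by positivity
  rcases lt_trichotomy x 0 with h | rfl | h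
  · rw [Real.sign_of_neg h, Real.sign_of_neg (mul_neg_of_pos_of_neg hc2 h)]
  · simp
  · rw [Real.sign_of_pos h, Real.sign_of_pos (mul_pos hc2 h)]

lemma lk_lineOf {p q r : Frame} (hpq : frameDet p q ≠ 0) (hpr : frameDet p r ≠ 0) :
    lk (lineOf p) (lineOf q) (lineOf r) =
      Real.sign (frameDet p q * frameDet p r * frameDet q r) := by
  have h : ∃ v : Fin 6 → V4, lineOf p = span ℝ {v 0, v 1} ∧ lineOf q = span ℝ {v 2, v 3} ∧
      lineOf r = span ℝ {v 4, v 5} := ⟨![p.1, p.2, q.1, q.2, r.1, r.2], rfl, rfl, rfl⟩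
  rw [lk, dif_pos h]
  obtain ⟨h1, h2, h3⟩ := h.choose_spec
  set v := h.choose
  obtain ⟨g, hg⟩ := exists_reframe_of_lineOf_le (p := p) (q := (v 0, v 1)) h1.le
  obtain ⟨k, hk⟩ := exists_reframe_of_lineOf_le (p := q) (q := (v 2, v 3)) h2.le
  obtain ⟨l, hl⟩ := exists_reframe_of_lineOf_le (p := r) (q := (v 4, v 5)) h3.le
  rw [hg, hk, frameDet_reframe] at hpq
  rw [hg, hl, frameDet_reframe] at hpr
  rw [hg, hk, hl, frameDet_reframe, frameDet_reframe, frameDet_reframe]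
  have hgk := left_ne_zero_of_mul hpq
  have hl0 := right_ne_zero_of_mul (left_ne_zero_of_mul hpr)
  change Real.sign (frameDet (v 0, v 1) (v 2, v 3) * frameDet (v 0, v 1) (v 4, v 5) *
    frameDet (v 2, v 3) (v 4, v 5)) = _
  rw [show coeffDet g * coeffDet k * frameDet (v 0, v 1) (v 2, v 3) *
      (coeffDet g * coeffDet l * frameDet (v 0, v 1) (v 4, v 5)) *
      (coeffDet k * coeffDet l * frameDet (v 2, v 3) (v 4, v 5)) =
      (coeffDet g * coeffDet k * coeffDet l) ^ 2 * (frameDet (v 0, v 1) (v 2, v 3) *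
        frameDet (v 0, v 1) (v 4, v 5) * frameDet (v 2, v 3) (v 4, v 5)) by ring]
  exact (sign_sq_mul (mul_ne_zero hgk hl0) _).symm

/-- The frames of configurations of skew lines. -/
def skewFrames (n : ℕ) : Set (Fin n → Frame) :=
  {x | ∀ i j, i ≠ j → frameDet (x i) (x j) ≠ 0}

/-- The lines spanned by a family of frames. -/
def linesOf {n : ℕ} (x : Fin n → Frame) : Fin n → PLine := fun i => lineOf (x i)

/-- Two configurations have frames that are joined by a path of frames of skew lines. -/
def FrameJoined {n : ℕ} (L L' : Fin n → PLine) : Prop :=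
  ∃ x y, linesOf x = L ∧ linesOf y = L' ∧ JoinedIn (skewFrames n) x y

lemma pairwiseSkew_linesOf_iff {n : ℕ} (x : Fin n → Frame) :
    PairwiseSkew (linesOf x) ↔ x ∈ skewFrames n := by
  simp only [PairwiseSkew, linesOf, skew_lineOf_iff, skewFrames, Set.mem_ofPred_eq]

lemma PairwiseSkew.exists_frames {L : Fin 5 → PLine} (h : PairwiseSkew L) :
    ∃ x ∈ skewFrames 5, linesOf x = L := by
  have hline : ∀ i, IsLine (L i) := fun i => by
    obtain ⟨j, hj⟩ := exists_ne i
    exact (h i j hj.symm).1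
  choose x hx using fun i => exists_lineOf (hline i)
  have hxL : linesOf x = L := funext fun i => (hx i).symm
  exact ⟨x, (pairwiseSkew_linesOf_iff x).1 (hxL ▸ h), hxL⟩

lemma continuousOn_frameDet {f g : ℝ → Frame} {s : Set ℝ} (hf : ContinuousOn f s)
    (hg : ContinuousOn g s) : ContinuousOn (fun t => frameDet (f t) (g t)) s := by
  simp only [frameDet_eq, plucker]
  fun_prop

lemma FrameJoined.deformation {n : ℕ} {L L' : Fin n → PLine} (h : FrameJoined L L') :
    Deformation L L' := by
  obtain ⟨x, y, rfl, rfl, hxy⟩ := h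
  set γ := hxy.somePath
  have hγ : Continuous γ.extend := γ.continuous_extend
  refine ⟨fun t => linesOf (γ.extend t), fun i => ⟨fun t => (γ.extend t i).1,
    fun t => (γ.extend t i).2, by fun_prop, by fun_prop, fun t _ => rfl⟩, fun t ht => ?_, ?_, ?_⟩
  · rw [pairwiseSkew_linesOf_iff, γ.extend_apply ht]
    exact hxy.somePath_mem _
  · simp
  · simp

lemma FrameJoined.symm {n : ℕ} {L L' : Fin n → PLine} (h : FrameJoined L L') :
    FrameJoined L' L := by
  obtain ⟨x, y, hx, hy, hxy⟩ := h
  exact ⟨y, x, hy, hx, hxy.symm⟩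

lemma FrameJoined.trans {L M N : Fin 5 → PLine} (h : FrameJoined L M)
    (h' : FrameJoined M N) : FrameJoined L N := by
  obtain ⟨x, y, hx, hy, hxy⟩ := h
  obtain ⟨y', z, hy', hz, hyz⟩ := h'
  have hle : ∀ i, lineOf (y i) ≤ lineOf (y' i) := fun i =>
    (congrFun (hy.trans hy'.symm) i).le
  choose g hg using fun i => exists_reframe_of_lineOf_le (hle i)
  have hg0 : ∀ i, coeffDet (g i) ≠ 0 := fun i => by
    obtain ⟨j, hj⟩ := exists_ne i
    have := hxy.target_mem i j hj.symm
    rw [hg i, hg j, frameDet_reframe] at this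
    exact left_ne_zero_of_mul (left_ne_zero_of_mul this)
  have hyy : y = fun i => reframe (g i) (y' i) := funext hg
  have hcont : Continuous fun (u : Fin 5 → Frame) (i : Fin 5) => reframe (g i) (u i) := by
    simp only [reframe]
    fun_prop
  have himage := hyz.map hcont
  rw [← hyy] at himage
  refine ⟨x, _, hx, ?_, hxy.trans (himage.mono ?_)⟩
  · rw [← hz]
    exact funext fun i => lineOf_reframe (hg0 i) _
  · rintro _ ⟨u, hu, rfl⟩ i j hij
    rw [frameDet_reframe]
    exact mul_ne_zero (mul_ne_zero (hg0 i) (hg0 j)) (hu i j hij)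

lemma frameJoined_of_joinedIn {n : ℕ} {x y : Fin n → Frame}
    (h : JoinedIn (skewFrames n) x y) : FrameJoined (linesOf x) (linesOf y) :=
  ⟨x, y, rfl, rfl, h⟩

lemma FrameJoined.refl {L : Fin 5 → PLine} (h : PairwiseSkew L) : FrameJoined L L := by
  obtain ⟨x, hx, rfl⟩ := h.exists_frames
  exact frameJoined_of_joinedIn (JoinedIn.refl hx)

lemma sign_eq_of_continuousOn {f : ℝ → ℝ} (hf : ContinuousOn f (Set.Icc 0 1))
    (h0 : ∀ t ∈ Set.Icc (0 : ℝ) 1, f t ≠ 0) : Real.sign (f 0) = Real.sign (f 1) := by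
  have h01 : (0 : ℝ) ≤ 1 := zero_le_one
  have hf0 := h0 0 (by simp)
  have hf1 := h0 1 (by simp)
  rcases lt_or_gt_of_ne hf0 with ha | ha <;> rcases lt_or_gt_of_ne hf1 with hb | hb
  · rw [Real.sign_of_neg ha, Real.sign_of_neg hb]
  · obtain ⟨t, ht, ht0⟩ := intermediate_value_Icc h01 hf ⟨ha.le, hb.le⟩
    exact absurd ht0 (h0 t ht)
  · obtain ⟨t, ht, ht0⟩ := intermediate_value_Icc' h01 hf ⟨hb.le, ha.le⟩
    exact absurd ht0 (h0 t ht)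
  · rw [Real.sign_of_pos ha, Real.sign_of_pos hb]

lemma Deformation.lk_eq {n : ℕ} {L L' : Fin n → PLine} (h : Deformation L L') {i j k : Fin n}
    (hij : i ≠ j) (hik : i ≠ k) (hjk : j ≠ k) :
    lk (L i) (L j) (L k) = lk (L' i) (L' j) (L' k) := by
  obtain ⟨F, hF, hskew, rfl, rfl⟩ := h
  choose v w hv hw hvw using hF
  obtain ⟨f, hline, hf⟩ : ∃ f : ℝ → Fin n → Frame,
      (∀ t ∈ Set.Icc (0 : ℝ) 1, ∀ i, F t i = lineOf (f t i)) ∧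
      ∀ i, ContinuousOn (fun t => f t i) (Set.Icc 0 1) :=
    ⟨fun t i => (v i t, w i t), fun t ht i => hvw i t ht, fun i => (hv i).prodMk (hw i)⟩
  have hdet : ∀ a b, a ≠ b → ∀ t ∈ Set.Icc (0 : ℝ) 1, frameDet (f t a) (f t b) ≠ 0 :=
    fun a b hab t ht => by
      have := hskew t ht a b hab
      rwa [hline t ht, hline t ht, skew_lineOf_iff] at this
  have hcont : ∀ a b, ContinuousOn (fun t => frameDet (f t a) (f t b)) (Set.Icc 0 1) :=
    fun a b => continuousOn_frameDet (hf a) (hf b)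
  have hlk : ∀ t ∈ Set.Icc (0 : ℝ) 1, lk (F t i) (F t j) (F t k) = Real.sign
      (frameDet (f t i) (f t j) * frameDet (f t i) (f t k) * frameDet (f t j) (f t k)) :=
    fun t ht => by
      rw [hline t ht, hline t ht, hline t ht, lk_lineOf (hdet i j hij t ht) (hdet i k hik t ht)]
  rw [hlk 0 (by simp), hlk 1 (by simp)]
  exact sign_eq_of_continuousOn (f := fun t => frameDet (f t i) (f t j) *
    frameDet (f t i) (f t k) * frameDet (f t j) (f t k))
    (((hcont i j).mul (hcont i k)).mul (hcont j k))
    fun t ht => mul_ne_zero (mul_ne_zero (hdet i j hij t ht) (hdet i k hik t ht))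
      (hdet j k hjk t ht)

lemma Real.sign_mul' (a b : ℝ) : Real.sign (a * b) = Real.sign a * Real.sign b := by
  rcases lt_trichotomy a 0 with ha | rfl | ha <;> rcases lt_trichotomy b 0 with hb | rfl | hb <;>
    simp [Real.sign_of_neg, Real.sign_of_pos, mul_pos_of_neg_of_neg, mul_neg_of_neg_of_pos,
      mul_neg_of_pos_of_neg, *]

lemma sgnOf_eq_ten (L : Fin 5 → PLine) : sgnOf L =
    lk (L 0) (L 1) (L 2) + lk (L 0) (L 1) (L 3) + lk (L 0) (L 1) (L 4) + lk (L 0) (L 2) (L 3)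
    + lk (L 0) (L 2) (L 4) + lk (L 0) (L 3) (L 4) + lk (L 1) (L 2) (L 3) + lk (L 1) (L 2) (L 4)
    + lk (L 1) (L 3) (L 4) + lk (L 2) (L 3) (L 4) := by
  simp [sgnOf, Fin.sum_univ_five]
  ring

lemma six_mul_sum_triples (s : Fin 5 → Fin 5 → ℝ) (hs : ∀ i j, s i j = s j i)
    (h0 : ∀ i, s i i = 0) :
    6 * (s 0 1 * s 0 2 * s 1 2 + s 0 1 * s 0 3 * s 1 3 + s 0 1 * s 0 4 * s 1 4
      + s 0 2 * s 0 3 * s 2 3 + s 0 2 * s 0 4 * s 2 4 + s 0 3 * s 0 4 * s 3 4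
      + s 1 2 * s 1 3 * s 2 3 + s 1 2 * s 1 4 * s 2 4 + s 1 3 * s 1 4 * s 3 4
      + s 2 3 * s 2 4 * s 3 4) = ∑ i, ∑ j, ∑ k, s i j * s i k * s j k := by
  simp only [Fin.sum_univ_five, h0, hs 1 0, hs 2 0, hs 3 0, hs 4 0, hs 2 1, hs 3 1, hs 4 1,
    hs 3 2, hs 4 2, hs 4 3]
  ring

lemma six_mul_sgnOf {x : Fin 5 → Frame} (hx : x ∈ skewFrames 5) :
    6 * sgnOf (linesOf x) = ∑ i, ∑ j, ∑ k,
      (if i = j then 0 else Real.sign (frameDet (x i) (x j))) *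
      (if i = k then 0 else Real.sign (frameDet (x i) (x k))) *
      (if j = k then 0 else Real.sign (frameDet (x j) (x k))) := by
  rw [← six_mul_sum_triples fun i j => if i = j then 0 else Real.sign (frameDet (x i) (x j))]
  · have hlk : ∀ i j k, i ≠ j → i ≠ k → lk (linesOf x i) (linesOf x j) (linesOf x k) =
        Real.sign (frameDet (x i) (x j)) * Real.sign (frameDet (x i) (x k)) *
          Real.sign (frameDet (x j) (x k)) := fun i j k hij hik => by
      rw [linesOf, linesOf, linesOf, lk_lineOf (hx i j hij) (hx i k hik), Real.sign_mul',
        Real.sign_mul']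
    simp [sgnOf_eq_ten, hlk]
  · intro i j
    simp only [eq_comm (a := i), frameDet_comm (x i)]
  · simp

lemma sgnOf_comp_perm {L : Fin 5 → PLine} (hL : PairwiseSkew L) (π : Equiv.Perm (Fin 5)) :
    sgnOf (L ∘ π) = sgnOf L := by
  obtain ⟨x, hx, rfl⟩ := hL.exists_frames
  have hxπ : x ∘ π ∈ skewFrames 5 := fun i j hij => hx _ _ (π.injective.ne hij)
  have h1 := six_mul_sgnOf hx
  have h2 := six_mul_sgnOf hxπ
  have hcomp : linesOf x ∘ π = linesOf (x ∘ π) := rfl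
  have h3 : (6 : ℝ) * sgnOf (linesOf (x ∘ π)) = 6 * sgnOf (linesOf x) := by
    rw [h1, h2]
    symm
    rw [← Equiv.sum_comp π]
    refine Finset.sum_congr rfl fun i _ => ?_
    rw [← Equiv.sum_comp π]
    refine Finset.sum_congr rfl fun j _ => ?_
    rw [← Equiv.sum_comp π]
    simp
  rw [hcomp]
  linarith

lemma DeformEquiv.sgnOf_eq {L L' : Fin 5 → PLine} (hL : PairwiseSkew L) (hL' : PairwiseSkew L')
    (h : DeformEquiv L L') : sgnOf L = sgnOf L' := by
  obtain ⟨π, π', hd⟩ := h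
  rw [← sgnOf_comp_perm hL π, ← sgnOf_comp_perm hL' π', sgnOf_eq_ten, sgnOf_eq_ten,
    hd.lk_eq (i := 0) (j := 1) (k := 2) (by decide) (by decide) (by decide),
    hd.lk_eq (i := 0) (j := 1) (k := 3) (by decide) (by decide) (by decide),
    hd.lk_eq (i := 0) (j := 1) (k := 4) (by decide) (by decide) (by decide),
    hd.lk_eq (i := 0) (j := 2) (k := 3) (by decide) (by decide) (by decide),
    hd.lk_eq (i := 0) (j := 2) (k := 4) (by decide) (by decide) (by decide),
    hd.lk_eq (i := 0) (j := 3) (k := 4) (by decide) (by decide) (by decide),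
    hd.lk_eq (i := 1) (j := 2) (k := 3) (by decide) (by decide) (by decide),
    hd.lk_eq (i := 1) (j := 2) (k := 4) (by decide) (by decide) (by decide),
    hd.lk_eq (i := 1) (j := 3) (k := 4) (by decide) (by decide) (by decide),
    hd.lk_eq (i := 2) (j := 3) (k := 4) (by decide) (by decide) (by decide)]

/-- The sign `±1` attached to a Boolean. -/
def boolSign (b : Bool) : ℝ := if b then 1 else -1

/-- The complete graph on five vertices with signed edges, all edges at the last vertex being
positive. -/
def signedEdge (b₀₁ b₀₂ b₀₃ b₁₂ b₁₃ b₂₃ : Bool) : Fin 5 → Fin 5 → Bool :=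
  ![![true, b₀₁, b₀₂, b₀₃, true], ![b₀₁, true, b₁₂, b₁₃, true], ![b₀₂, b₁₂, true, b₂₃, true],
    ![b₀₃, b₁₃, b₂₃, true, true], ![true, true, true, true, true]]

/-- Whether the product of the signs of the edges of a triangle is positive. -/
def triangleSign (e : Fin 5 → Fin 5 → Bool) (i j k : Fin 5) : Bool := (e i j == e i k) == e j k

/-- The number of positive triangles. -/
def positiveTriangles (e : Fin 5 → Fin 5 → Bool) : ℕ :=
  (triangleSign e 0 1 2).toNat + (triangleSign e 0 1 3).toNat + (triangleSign e 0 1 4).toNat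
  + (triangleSign e 0 2 3).toNat + (triangleSign e 0 2 4).toNat + (triangleSign e 0 3 4).toNat
  + (triangleSign e 1 2 3).toNat + (triangleSign e 1 2 4).toNat + (triangleSign e 1 3 4).toNat
  + (triangleSign e 2 3 4).toNat

/-- The positive edges, among the first four vertices, of a representative of the switching
class with the given number of positive triangles. -/
def standardEdges : ℕ → List (Fin 5 × Fin 5)
  | 0 => []
  | 3 => [(0, 1)]
  | 4 => [(0, 1), (1, 3)]
  | 5 => [(0, 1), (1, 3), (2, 3)]
  | 6 => [(0, 1), (2, 3)]
  | 7 => [(0, 1), (0, 3), (1, 3)]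
  | _ => [(0, 1), (0, 2), (0, 3), (1, 2), (1, 3), (2, 3)]

/-- Renumberings of the vertices that suffice to reach the standard representatives. -/
def renumberings : List (Fin 5 → Fin 5) :=
  [![0, 1, 2, 3, 4], ![0, 2, 1, 3, 4], ![0, 3, 1, 4, 2], ![0, 4, 1, 2, 3], ![1, 2, 0, 3, 4],
   ![1, 3, 0, 4, 2], ![1, 4, 2, 0, 3], ![2, 3, 0, 4, 1], ![2, 4, 0, 1, 3], ![0, 2, 3, 1, 4],
   ![3, 4, 1, 2, 0], ![0, 1, 3, 4, 2], ![0, 3, 4, 2, 1], ![1, 4, 2, 3, 0], ![2, 0, 3, 4, 1],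
   ![3, 1, 2, 4, 0], ![1, 0, 2, 4, 3], ![1, 0, 3, 2, 4]]

lemma injective_of_mem_renumberings : ∀ f ∈ renumberings, Function.Injective f := by
  decide +kernel

lemma exists_renumbering : ∀ b₀₁ b₀₂ b₀₃ b₁₂ b₁₃ b₂₃ : Bool, ∃ f ∈ renumberings,
    ∀ i j : Fin 5, i < j → j < 4 →
      triangleSign (signedEdge b₀₁ b₀₂ b₀₃ b₁₂ b₁₃ b₂₃) (f i) (f j) (f 4) =
        decide ((i, j) ∈ standardEdges
          (positiveTriangles (signedEdge b₀₁ b₀₂ b₀₃ b₁₂ b₁₃ b₂₃))) := by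
  decide +kernel

lemma boolSign_beq (a b : Bool) : boolSign (a == b) = boolSign a * boolSign b := by
  cases a <;> cases b <;> simp [boolSign]

lemma boolSign_eq_toNat (b : Bool) : boolSign b = 2 * (b.toNat : ℝ) - 1 := by
  cases b <;> norm_num [boolSign]

lemma sign_eq_boolSign {a : ℝ} (ha : a ≠ 0) : Real.sign a = boolSign (decide (0 < a)) := by
  rcases lt_or_gt_of_ne ha with h | h
  · simp [Real.sign_of_neg h, boolSign, h.le]
  · simp [Real.sign_of_pos h, boolSign, h]

lemma PairwiseSkew.exists_frames_pos {L : Fin 5 → PLine} (h : PairwiseSkew L) :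
    ∃ x ∈ skewFrames 5, linesOf x = L ∧ ∀ i, i ≠ 4 → 0 < frameDet (x i) (x 4) := by
  obtain ⟨x, hx, rfl⟩ := h.exists_frames
  have hid : ∀ p : Frame, reframe ![1, 0, 0, 1] p = p := fun p => by simp [reframe]
  let g : Fin 5 → Fin 4 → ℝ := fun i =>
    if i ≠ 4 ∧ frameDet (x i) (x 4) < 0 then ![0, 1, 1, 0] else ![1, 0, 0, 1]
  have hg : ∀ i, coeffDet (g i) ≠ 0 := fun i => by
    by_cases hi : i ≠ 4 ∧ frameDet (x i) (x 4) < 0 <;> simp [g, hi, coeffDet]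
  refine ⟨fun i => reframe (g i) (x i), fun i j hij => ?_, funext fun i => ?_, fun i hi => ?_⟩
  · rw [frameDet_reframe]
    exact mul_ne_zero (mul_ne_zero (hg i) (hg j)) (hx i j hij)
  · exact lineOf_reframe (hg i) _
  · rw [frameDet_reframe]
    rcases lt_or_gt_of_ne (hx i 4 hi) with h' | h'
    · simp [g, hi, h', coeffDet]
    · simp [g, h'.not_gt, coeffDet, h']

lemma signedEdge_eq {b : Fin 5 → Fin 5 → Bool} (hb : ∀ i j, b i j = b j i)
    (hb4 : ∀ i, i ≠ 4 → b i 4 = true) {i j : Fin 5} (hij : i ≠ j) :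
    signedEdge (b 0 1) (b 0 2) (b 0 3) (b 1 2) (b 1 3) (b 2 3) i j = b i j := by
  have h0 := hb4 0 (by decide)
  have h1 := hb4 1 (by decide)
  have h2 := hb4 2 (by decide)
  have h3 := hb4 3 (by decide)
  fin_cases i <;> fin_cases j <;>
    simp [signedEdge, h0, h1, h2, h3, hb 1 0, hb 2 0, hb 3 0, hb 4 0, hb 2 1, hb 3 1, hb 4 1,
      hb 3 2, hb 4 2, hb 4 3] at hij ⊢

/-- A configuration whose linking indices with the last line are those prescribed by a list of
positive edges. -/
def HasEdges (L : Fin 5 → PLine) (l : List (Fin 5 × Fin 5)) : Prop :=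
  ∀ i j, i < j → j < 4 → lk (L i) (L j) (L 4) = boolSign (decide ((i, j) ∈ l))

lemma PairwiseSkew.exists_perm_hasEdges {L : Fin 5 → PLine} (h : PairwiseSkew L) :
    ∃ (π : Equiv.Perm (Fin 5)) (m : ℕ), sgnOf L = 2 * m - 10 ∧
      HasEdges (L ∘ π) (standardEdges m) := by
  obtain ⟨x, hx, rfl, hpos⟩ := h.exists_frames_pos
  let b : Fin 5 → Fin 5 → Bool := fun i j => decide (0 < frameDet (x i) (x j))
  let e := signedEdge (b 0 1) (b 0 2) (b 0 3) (b 1 2) (b 1 3) (b 2 3)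
  have hb : ∀ i j, b i j = b j i := fun i j => by simp only [b, frameDet_comm (x i)]
  have hb4 : ∀ i, i ≠ 4 → b i 4 = true := fun i hi => by simp [b, hpos i hi]
  have he : ∀ i j, i ≠ j → Real.sign (frameDet (x i) (x j)) = boolSign (e i j) := by
    intro i j hij
    have heb : e i j = b i j := signedEdge_eq hb hb4 hij
    rw [heb, sign_eq_boolSign (hx i j hij)]
  have hlk : ∀ i j k, i ≠ j → i ≠ k → j ≠ k →
      lk (linesOf x i) (linesOf x j) (linesOf x k) = boolSign (triangleSign e i j k) := by
    intro i j k hij hik hjk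
    rw [linesOf, linesOf, linesOf, lk_lineOf (hx i j hij) (hx i k hik), Real.sign_mul',
      Real.sign_mul', he i j hij, he i k hik, he j k hjk, triangleSign, boolSign_beq,
      boolSign_beq]
  obtain ⟨f, hf, hfe⟩ := exists_renumbering (b 0 1) (b 0 2) (b 0 3) (b 1 2) (b 1 3) (b 2 3)
  have hinj := injective_of_mem_renumberings f hf
  refine ⟨Equiv.ofBijective f (Finite.injective_iff_bijective.1 hinj), positiveTriangles e,
    ?_, fun i j hij hj => ?_⟩
  · rw [sgnOf_eq_ten]
    simp only [hlk _ _ _ (by decide : (0 : Fin 5) ≠ 1) (by decide : (0 : Fin 5) ≠ 2) (by decide),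
      hlk _ _ _ (by decide : (0 : Fin 5) ≠ 1) (by decide : (0 : Fin 5) ≠ 3) (by decide),
      hlk _ _ _ (by decide : (0 : Fin 5) ≠ 1) (by decide : (0 : Fin 5) ≠ 4) (by decide),
      hlk _ _ _ (by decide : (0 : Fin 5) ≠ 2) (by decide : (0 : Fin 5) ≠ 3) (by decide),
      hlk _ _ _ (by decide : (0 : Fin 5) ≠ 2) (by decide : (0 : Fin 5) ≠ 4) (by decide),
      hlk _ _ _ (by decide : (0 : Fin 5) ≠ 3) (by decide : (0 : Fin 5) ≠ 4) (by decide),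
      hlk _ _ _ (by decide : (1 : Fin 5) ≠ 2) (by decide : (1 : Fin 5) ≠ 3) (by decide),
      hlk _ _ _ (by decide : (1 : Fin 5) ≠ 2) (by decide : (1 : Fin 5) ≠ 4) (by decide),
      hlk _ _ _ (by decide : (1 : Fin 5) ≠ 3) (by decide : (1 : Fin 5) ≠ 4) (by decide),
      hlk _ _ _ (by decide : (2 : Fin 5) ≠ 3) (by decide : (2 : Fin 5) ≠ 4) (by decide),
      boolSign_eq_toNat, positiveTriangles]
    push_cast
    ring
  · have hij4 : i ≠ 4 := (hij.trans hj).ne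
    refine (hlk _ _ _ (hinj.ne hij.ne) (hinj.ne hij4) (hinj.ne hj.ne)).trans ?_
    exact congrArg boolSign (hfe i j hij hj)

lemma joinedIn_of_family {n : ℕ} {x : Fin n → Frame} (hx : x ∈ skewFrames n)
    (T : ℝ → V4 → V4) (hT0 : ∀ v, T 0 v = v) (hT : ∀ v, Continuous fun t => T t v)
    (hdet : ∀ t a b c d, det2 (T t a) (T t b) (T t c) (T t d) = det2 a b c d) (r : ℝ) :
    JoinedIn (skewFrames n) x fun i => (T r (x i).1, T r (x i).2) := by
  refine JoinedIn.ofLine (f := fun t i => (T (r * t) (x i).1, T (r * t) (x i).2)) ?_ ?_ ?_ ?_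
  · exact (continuous_pi fun i => (((hT _).comp (continuous_const_mul r)).prodMk
      ((hT _).comp (continuous_const_mul r)))).continuousOn
  · simp [hT0]
  · simp
  · rintro _ ⟨t, -, rfl⟩ i j hij
    have := hx i j hij
    rwa [frameDet, ← hdet (r * t)] at this

/-- The shear adding multiples of the first two coordinates to the last two. -/
def shearDown (c : Fin 4 → ℝ) (v : V4) : V4 :=
  ![v 0, v 1, v 2 + c 0 * v 0 + c 1 * v 1, v 3 + c 2 * v 0 + c 3 * v 1]

/-- The shear adding multiples of the last two coordinates to the first two. -/
def shearUp (c : Fin 4 → ℝ) (v : V4) : V4 :=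
  ![v 0 + c 0 * v 2 + c 1 * v 3, v 1 + c 2 * v 2 + c 3 * v 3, v 2, v 3]

/-- The rotation in the plane of the second and fourth coordinates. -/
noncomputable def planeRotation (t : ℝ) (v : V4) : V4 :=
  ![v 0, Real.cos t * v 1 - Real.sin t * v 3, v 2, Real.sin t * v 1 + Real.cos t * v 3]

lemma joinedIn_shearDown {n : ℕ} {x : Fin n → Frame} (hx : x ∈ skewFrames n) (c : Fin 4 → ℝ) :
    JoinedIn (skewFrames n) x fun i => (shearDown c (x i).1, shearDown c (x i).2) := by
  have := joinedIn_of_family hx (fun t v => shearDown (t • c) v) ?_ ?_ ?_ 1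
  · simpa using this
  · intro v
    ext i
    fin_cases i <;> simp [shearDown]
  · intro v
    refine continuous_pi fun i => ?_
    fin_cases i <;> simp [shearDown] <;> fun_prop
  · intro t a b c d
    simp [det2_eq, shearDown]
    ring

lemma joinedIn_shearUp {n : ℕ} {x : Fin n → Frame} (hx : x ∈ skewFrames n) (c : Fin 4 → ℝ) :
    JoinedIn (skewFrames n) x fun i => (shearUp c (x i).1, shearUp c (x i).2) := by
  have := joinedIn_of_family hx (fun t v => shearUp (t • c) v) ?_ ?_ ?_ 1
  · simpa using this
  · intro v
    ext i
    fin_cases i <;> simp [shearUp]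
  · intro v
    refine continuous_pi fun i => ?_
    fin_cases i <;> simp [shearUp] <;> fun_prop
  · intro t a b c d
    simp [det2_eq, shearUp]
    ring

lemma joinedIn_planeRotation {n : ℕ} {x : Fin n → Frame} (hx : x ∈ skewFrames n) (r : ℝ) :
    JoinedIn (skewFrames n) x fun i => (planeRotation r (x i).1, planeRotation r (x i).2) := by
  refine joinedIn_of_family hx planeRotation ?_ ?_ ?_ r
  · intro v
    ext i
    fin_cases i <;> simp [planeRotation]
  · intro v
    refine continuous_pi fun i => ?_
    fin_cases i <;> simp [planeRotation] <;> fun_prop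
  · intro t a b c d
    have h := Real.sin_sq_add_cos_sq t
    have h' : Real.cos t ^ 2 = 1 - Real.sin t ^ 2 := by linarith
    simp [det2_eq, planeRotation]
    ring_nf
    rw [h']
    ring

/-- The frame of the graph of a two by two matrix. -/
def graphFrame (A : Matrix (Fin 2) (Fin 2) ℝ) : Frame :=
  (![1, 0, A 0 0, A 0 1], ![0, 1, A 1 0, A 1 1])

/-- The frames of four graphs of matrices and of the line at infinity of the matrix chart. -/
def chartFrames (A : Fin 5 → Matrix (Fin 2) (Fin 2) ℝ) : Fin 5 → Frame :=
  fun i => if i = 4 then (![0, 0, 1, 0], ![0, 0, 0, 1]) else graphFrame (A i)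

/-- The configuration of the graphs of four matrices and of the line at infinity. -/
def chartLines (A : Fin 5 → Matrix (Fin 2) (Fin 2) ℝ) : Fin 5 → PLine := linesOf (chartFrames A)

/-- The matrix coordinates of configurations of skew lines; the last matrix is irrelevant. -/
def chartSet : Set (Fin 5 → Matrix (Fin 2) (Fin 2) ℝ) :=
  {A | ∀ i j, i ≠ j → i ≠ 4 → j ≠ 4 → (A i - A j).det ≠ 0}

lemma det_sub_comm (A B : Matrix (Fin 2) (Fin 2) ℝ) : (A - B).det = (B - A).det := by
  simp only [Matrix.det_fin_two, Matrix.sub_apply]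
  ring

lemma frameDet_graphFrame (A B : Matrix (Fin 2) (Fin 2) ℝ) :
    frameDet (graphFrame A) (graphFrame B) = (A - B).det := by
  simp [frameDet_eq, plucker, graphFrame, Matrix.det_fin_two]
  ring

lemma frameDet_graphFrame_infinity (A : Matrix (Fin 2) (Fin 2) ℝ) :
    frameDet (graphFrame A) (![0, 0, 1, 0], ![0, 0, 0, 1]) = 1 := by
  simp [frameDet_eq, plucker, graphFrame]

lemma frameDet_infinity_graphFrame (A : Matrix (Fin 2) (Fin 2) ℝ) :
    frameDet (![0, 0, 1, 0], ![0, 0, 0, 1]) (graphFrame A) = 1 := by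
  rw [frameDet_comm, frameDet_graphFrame_infinity]

lemma chartFrames_mem_iff (A : Fin 5 → Matrix (Fin 2) (Fin 2) ℝ) :
    chartFrames A ∈ skewFrames 5 ↔ A ∈ chartSet := by
  constructor
  · intro h i j hij hi hj
    have := h i j hij
    rwa [chartFrames, chartFrames, if_neg hi, if_neg hj, frameDet_graphFrame] at this
  · intro h i j hij
    by_cases hi : i = 4
    · have hj : j ≠ 4 := fun hj => hij (hi.trans hj.symm)
      rw [chartFrames, chartFrames, if_pos hi, if_neg hj, frameDet_infinity_graphFrame]
      exact one_ne_zero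
    · by_cases hj : j = 4
      · rw [chartFrames, chartFrames, if_neg hi, if_pos hj, frameDet_graphFrame_infinity]
        exact one_ne_zero
      · rw [chartFrames, chartFrames, if_neg hi, if_neg hj, frameDet_graphFrame]
        exact h i j hij hi hj

lemma lk_chartLines {A : Fin 5 → Matrix (Fin 2) (Fin 2) ℝ} (hA : A ∈ chartSet) {i j : Fin 5}
    (hij : i < j) (hj : j < 4) :
    lk (chartLines A i) (chartLines A j) (chartLines A 4) = Real.sign (A i - A j).det := by
  have hx := (chartFrames_mem_iff A).2 hA
  have hi4 : i ≠ 4 := (hij.trans hj).ne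
  rw [chartLines, linesOf, linesOf, linesOf, lk_lineOf (hx i j hij.ne) (hx i 4 hi4)]
  simp only [chartFrames, if_neg hi4, if_neg hj.ne, if_true, frameDet_graphFrame,
    frameDet_graphFrame_infinity, mul_one]

lemma continuous_chartFrames : Continuous chartFrames := by
  refine continuous_pi fun i => ?_
  by_cases hi : i = 4
  · simp only [chartFrames, if_pos hi]
    fun_prop
  · simp only [chartFrames, if_neg hi, graphFrame]
    refine Continuous.prodMk (continuous_pi fun k => ?_) (continuous_pi fun k => ?_) <;>
      fin_cases k <;> simp <;> fun_prop

lemma frameJoined_of_joinedIn_chartSet {A B : Fin 5 → Matrix (Fin 2) (Fin 2) ℝ}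
    (h : JoinedIn chartSet A B) : FrameJoined (chartLines A) (chartLines B) := by
  refine frameJoined_of_joinedIn ((h.map continuous_chartFrames).mono ?_)
  rintro _ ⟨C, hC, rfl⟩
  exact (chartFrames_mem_iff C).2 hC

lemma exists_shearDown {p q : Frame} (h : frameDet p q ≠ 0) :
    ∃ c, plucker (shearDown c p.1, shearDown c p.2) 2 3 ≠ 0 := by
  by_contra! hc
  have hexp : ∀ c : Fin 4 → ℝ, plucker p 2 3 + c 0 * plucker p 0 3 + c 1 * plucker p 1 3
      - c 2 * plucker p 0 2 - c 3 * plucker p 1 2 + (c 0 * c 3 - c 1 * c 2) * plucker p 0 1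
      = 0 := fun c => by
    rw [← hc c]
    simp [plucker, shearDown]
    ring
  have h0 := hexp 0
  have h1 := hexp ![1, 0, 0, 0]
  have h2 := hexp ![0, 1, 0, 0]
  have h3 := hexp ![0, 0, 1, 0]
  have h4 := hexp ![0, 0, 0, 1]
  have h5 := hexp ![1, 0, 0, 1]
  simp at h0
  simp [h0] at h1 h2 h3 h4
  simp [h0, h1, h4] at h5
  exact h (by rw [frameDet_eq]; simp [*])

lemma exists_lineOf_eq_graphFrame {p : Frame} (h : plucker p 0 1 ≠ 0) :
    ∃ A, lineOf p = lineOf (graphFrame A) := by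
  let g : Fin 4 → ℝ := ![p.2 1 / plucker p 0 1, -p.1 1 / plucker p 0 1, -p.2 0 / plucker p 0 1,
    p.1 0 / plucker p 0 1]
  have hg : coeffDet g = (plucker p 0 1)⁻¹ := by
    simp [g, coeffDet]
    field_simp
    simp [plucker]
    ring
  refine ⟨!![(reframe g p).1 2, (reframe g p).1 3; (reframe g p).2 2, (reframe g p).2 3], ?_⟩
  rw [← lineOf_reframe (g := g) (by rw [hg]; exact inv_ne_zero h) p]
  congr 1
  refine Prod.ext ?_ ?_ <;> ext i <;> fin_cases i <;> simp [graphFrame] <;>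
    simp [reframe, g] <;> field_simp <;> simp [plucker] <;> ring

lemma lineOf_eq_infinity {p : Frame} (h : plucker p 2 3 ≠ 0) (h10 : p.1 0 = 0) (h11 : p.1 1 = 0)
    (h20 : p.2 0 = 0) (h21 : p.2 1 = 0) :
    lineOf p = lineOf (![0, 0, 1, 0], ![0, 0, 0, 1]) := by
  let g : Fin 4 → ℝ := ![p.1 2, p.1 3, p.2 2, p.2 3]
  have hp : p = reframe g (![0, 0, 1, 0], ![0, 0, 0, 1]) := by
    refine Prod.ext ?_ ?_ <;> ext i <;> fin_cases i <;> simp [reframe, g, *]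
  conv_lhs => rw [hp]
  exact lineOf_reframe (g := g) h _

lemma exists_frameJoined_chartLines {L : Fin 5 → PLine} (h : PairwiseSkew L) :
    ∃ A ∈ chartSet, FrameJoined L (chartLines A) := by
  obtain ⟨x, hx, rfl⟩ := h.exists_frames
  obtain ⟨c, hc⟩ := exists_shearDown (hx 4 0 (by decide))
  have hy := joinedIn_shearDown hx c
  set y : Fin 5 → Frame := fun i => (shearDown c (x i).1, shearDown c (x i).2)
  let d : Fin 4 → ℝ := ![-((y 4).1 0 * (y 4).2 3 - (y 4).2 0 * (y 4).1 3) / plucker (y 4) 2 3,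
    -((y 4).1 2 * (y 4).2 0 - (y 4).2 2 * (y 4).1 0) / plucker (y 4) 2 3,
    -((y 4).1 1 * (y 4).2 3 - (y 4).2 1 * (y 4).1 3) / plucker (y 4) 2 3,
    -((y 4).1 2 * (y 4).2 1 - (y 4).2 2 * (y 4).1 1) / plucker (y 4) 2 3]
  have hc' : plucker (y 4) 2 3 ≠ 0 := hc
  have hz := joinedIn_shearUp hy.target_mem d
  set z : Fin 5 → Frame := fun i => (shearUp d (y i).1, shearUp d (y i).2)
  have z10 : (z 4).1 0 = 0 := by
    simp [z, shearUp, d]; field_simp; simp [plucker]; ring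
  have z11 : (z 4).1 1 = 0 := by
    simp [z, shearUp, d]; field_simp; simp [plucker]; ring
  have z20 : (z 4).2 0 = 0 := by
    simp [z, shearUp, d]; field_simp; simp [plucker]; ring
  have z21 : (z 4).2 1 = 0 := by
    simp [z, shearUp, d]; field_simp; simp [plucker]; ring
  have hz4 : plucker (z 4) 2 3 ≠ 0 := hc
  have hzi : ∀ i, ∃ A, i ≠ 4 → lineOf (z i) = lineOf (graphFrame A) := fun i => by
    by_cases hi : i = 4
    · exact ⟨0, fun h => absurd hi h⟩
    · have hdet := hz.target_mem i 4 hi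
      simp only [frameDet_eq, plucker, z10, z11, z20, z21] at hdet
      obtain ⟨A, hA⟩ := exists_lineOf_eq_graphFrame (p := z i) fun h0 => hdet (by
        simp only [plucker] at h0
        rw [h0]
        ring)
      exact ⟨A, fun _ => hA⟩
  choose A hA using hzi
  have hlines : linesOf z = chartLines A := funext fun i => by
    by_cases hi : i = 4
    · subst hi
      exact lineOf_eq_infinity hz4 z10 z11 z20 z21
    · simp only [linesOf, chartLines, chartFrames, if_neg hi, hA i hi]
  refine ⟨A, ?_, hlines ▸ frameJoined_of_joinedIn (hy.trans hz)⟩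
  rw [← chartFrames_mem_iff, ← pairwiseSkew_linesOf_iff]
  change PairwiseSkew (chartLines A)
  rw [← hlines, pairwiseSkew_linesOf_iff]
  exact hz.target_mem

lemma mem_chartSet_iff (A : Fin 5 → Matrix (Fin 2) (Fin 2) ℝ) :
    A ∈ chartSet ↔ ∀ i j, i < j → j < 4 → (A i - A j).det ≠ 0 := by
  refine ⟨fun h i j hij hj => h i j hij.ne (hij.trans hj).ne hj.ne, fun h i j hij hi hj => ?_⟩
  have hi' : i < 4 := lt_of_le_of_ne (Fin.le_last i) hi
  have hj' : j < 4 := lt_of_le_of_ne (Fin.le_last j) hj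
  rcases lt_or_gt_of_ne hij with h' | h'
  · exact h i j h' hj'
  · rw [det_sub_comm]
    exact h j i h' hi'

lemma joinedIn_one_of_trace_nonneg {g : Matrix (Fin 2) (Fin 2) ℝ} (hg : 0 < g.det)
    (ht : 0 ≤ g 0 0 + g 1 1) : JoinedIn {g : Matrix (Fin 2) (Fin 2) ℝ | 0 < g.det} 1 g := by
  refine JoinedIn.ofLine (f := fun t => (1 - t) • (1 : Matrix (Fin 2) (Fin 2) ℝ) + t • g)
    (by fun_prop) (by simp) (by simp) ?_
  rintro _ ⟨t, ⟨h0, h1⟩, rfl⟩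
  have hexp : ((1 - t) • (1 : Matrix (Fin 2) (Fin 2) ℝ) + t • g).det =
      (1 - t) ^ 2 + t * (1 - t) * (g 0 0 + g 1 1) + t ^ 2 * g.det := by
    simp [Matrix.det_fin_two]
    ring
  have h2 : 0 ≤ t * (1 - t) * (g 0 0 + g 1 1) :=
    mul_nonneg (mul_nonneg h0 (sub_nonneg.2 h1)) ht
  rw [Set.mem_ofPred_eq, hexp]
  rcases h0.eq_or_lt with rfl | h0
  · norm_num
  · have := mul_pos (pow_pos h0 2) hg
    have := sq_nonneg (1 - t)
    linarith

lemma joinedIn_one_of_det_pos {g : Matrix (Fin 2) (Fin 2) ℝ} (hg : 0 < g.det) :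
    JoinedIn {g : Matrix (Fin 2) (Fin 2) ℝ | 0 < g.det} 1 g := by
  rcases le_or_gt 0 (g 0 0 + g 1 1) with ht | ht
  · exact joinedIn_one_of_trace_nonneg hg ht
  have hneg : (-g).det = g.det := by simp [Matrix.det_fin_two]
  have h1 : JoinedIn {g : Matrix (Fin 2) (Fin 2) ℝ | 0 < g.det} 1 (-1) := by
    refine JoinedIn.ofLine (f := fun t => !![Real.cos (Real.pi * t), -Real.sin (Real.pi * t);
      Real.sin (Real.pi * t), Real.cos (Real.pi * t)]) ?_ ?_ ?_ ?_
    · refine Continuous.continuousOn (continuous_pi fun i => continuous_pi fun j => ?_)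
      fin_cases i <;> fin_cases j <;> simp <;> fun_prop
    · ext i j
      fin_cases i <;> fin_cases j <;> simp
    · ext i j
      fin_cases i <;> fin_cases j <;> simp
    · rintro _ ⟨t, -, rfl⟩
      have := Real.sin_sq_add_cos_sq (Real.pi * t)
      rw [Set.mem_ofPred_eq, Matrix.det_fin_two_of]
      nlinarith
  have h2 := joinedIn_one_of_trace_nonneg (g := -g) (hneg ▸ hg) (by simp; linarith)
  refine h1.trans ?_
  have h3 := h2.map (f := fun h => -h) continuous_neg
  rw [neg_neg] at h3
  refine h3.mono ?_
  rintro _ ⟨h, hh, rfl⟩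
  have : (-h).det = h.det := by simp [Matrix.det_fin_two]
  rwa [Set.mem_ofPred_eq, this]

lemma mul_mul_mem_chartSet {A : Fin 5 → Matrix (Fin 2) (Fin 2) ℝ} (hA : A ∈ chartSet)
    {g h : Matrix (Fin 2) (Fin 2) ℝ} (hg : g.det ≠ 0) (hh : h.det ≠ 0) :
    (fun i => g * A i * h) ∈ chartSet := by
  intro i j hij hi hj
  rw [← sub_mul, ← mul_sub, Matrix.det_mul, Matrix.det_mul]
  exact mul_ne_zero (mul_ne_zero hg (hA i j hij hi hj)) hh

lemma joinedIn_mul_mul {A : Fin 5 → Matrix (Fin 2) (Fin 2) ℝ} (hA : A ∈ chartSet)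
    {g h : Matrix (Fin 2) (Fin 2) ℝ} (hg : 0 < g.det) (hh : 0 < h.det) :
    JoinedIn chartSet A fun i => g * A i * h := by
  have h1 : JoinedIn chartSet A fun i => g * A i := by
    have := (joinedIn_one_of_det_pos hg).map
      (f := fun g : Matrix (Fin 2) (Fin 2) ℝ => fun i => g * A i) (by fun_prop)
    simp only [one_mul] at this
    refine this.mono ?_
    rintro _ ⟨g, hg, rfl⟩
    simpa using mul_mul_mem_chartSet hA (ne_of_gt hg) (h := 1) (by simp)
  have h2 := (joinedIn_one_of_det_pos hh).map
      (f := fun h : Matrix (Fin 2) (Fin 2) ℝ => fun i => g * A i * h) (by fun_prop)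
  simp only [mul_one] at h2
  refine h1.trans (h2.mono ?_)
  rintro _ ⟨h, hh, rfl⟩
  exact mul_mul_mem_chartSet hA hg.ne' (ne_of_gt hh)

lemma joinedIn_sub {A : Fin 5 → Matrix (Fin 2) (Fin 2) ℝ} (hA : A ∈ chartSet)
    (C : Matrix (Fin 2) (Fin 2) ℝ) : JoinedIn chartSet A fun i => A i - C := by
  refine JoinedIn.ofLine (f := fun t i => A i - t • C) (by fun_prop) (by simp) (by simp) ?_
  rintro _ ⟨t, -, rfl⟩ i j hij hi hj
  rw [sub_sub_sub_cancel_right]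
  exact hA i j hij hi hj

lemma joinedIn_of_forall_ne_four {A B : Fin 5 → Matrix (Fin 2) (Fin 2) ℝ} (hA : A ∈ chartSet)
    (h : ∀ i, i ≠ 4 → A i = B i) : JoinedIn chartSet A B := by
  refine JoinedIn.ofLine (f := fun t i => (1 - t) • A i + t • B i) (by fun_prop) (by simp)
    (by simp) ?_
  rintro _ ⟨t, -, rfl⟩ i j hij hi hj
  have key : ∀ i, i ≠ 4 → (1 - t) • A i + t • B i = A i := fun i hi => by
    rw [← h i hi, ← add_smul, sub_add_cancel, one_smul]
  simp only [key i hi, key j hj]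
  exact hA i j hij hi hj

/-- The matrix of a direct similarity of the plane. -/
def similarity (p q : ℝ) : Matrix (Fin 2) (Fin 2) ℝ := !![p, -q; q, p]

lemma det_similarity_sub (p q p' q' : ℝ) :
    (similarity p q - similarity p' q').det = (p - p') ^ 2 + (q - q') ^ 2 := by
  simp [similarity, Matrix.det_fin_two]
  ring

lemma continuous_similarity : Continuous fun z : ℝ × ℝ => similarity z.1 z.2 := by
  refine continuous_pi fun i => continuous_pi fun j => ?_
  fin_cases i <;> fin_cases j <;> simp [similarity] <;> fun_prop

lemma joinedIn_similarity {A : Fin 5 → Matrix (Fin 2) (Fin 2) ℝ}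
    (hA : ∀ i j, i < j → j < 4 → 0 < (A i - A j).det) :
    ∃ p q : Fin 5 → ℝ, JoinedIn chartSet A fun i => similarity (p i) (q i) := by
  refine ⟨fun i => (A i 0 0 + A i 1 1) / 2, fun i => (A i 1 0 - A i 0 1) / 2, ?_⟩
  set S : Fin 5 → Matrix (Fin 2) (Fin 2) ℝ :=
    fun i => similarity ((A i 0 0 + A i 1 1) / 2) ((A i 1 0 - A i 0 1) / 2) with hS
  refine JoinedIn.ofLine (f := fun t i => (1 - t) • A i + t • S i) (by fun_prop) (by simp)
    (by simp) ?_
  rintro _ ⟨t, ⟨h0, h1⟩, rfl⟩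
  rw [mem_chartSet_iff]
  intro i j hij hj
  have hdet := hA i j hij hj
  set a := A i 0 0 - A j 0 0 with ha
  set b := A i 0 1 - A j 0 1 with hb
  set c := A i 1 0 - A j 1 0 with hc
  set d := A i 1 1 - A j 1 1 with hd
  have e1 : (A i - A j).det = a * d - b * c := by simp [Matrix.det_fin_two, ha, hb, hc, hd]
  have e2 : ((1 - t) • A i + t • S i - ((1 - t) • A j + t • S j)).det =
      (a * d - b * c) + (1 - (1 - t) ^ 2) * (((a - d) / 2) ^ 2 + ((b + c) / 2) ^ 2) := by
    simp [Matrix.det_fin_two, hS, similarity, ha, hb, hc, hd]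
    ring
  rw [e1] at hdet
  have h2 : 0 ≤ 1 - (1 - t) ^ 2 := by nlinarith
  have h3 : 0 ≤ (1 - (1 - t) ^ 2) * (((a - d) / 2) ^ 2 + ((b + c) / 2) ^ 2) :=
    mul_nonneg h2 (by positivity)
  rw [e2]
  linarith

lemma joinedIn_scalar_of_det_pos {A : Fin 5 → Matrix (Fin 2) (Fin 2) ℝ}
    (hA : ∀ i j, i < j → j < 4 → 0 < (A i - A j).det) :
    JoinedIn chartSet A fun i => similarity (i : ℕ) 0 := by
  obtain ⟨p, q, hpq⟩ := joinedIn_similarity hA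
  obtain ⟨s, hs⟩ := Infinite.exists_notMem_finset
    (Finset.univ.image fun z : Fin 5 × Fin 5 => (q z.1 - q z.2) / (p z.1 - p z.2))
  have hs' : ∀ i j, s ≠ (q i - q j) / (p i - p j) := fun i j h =>
    hs (Finset.mem_image.2 ⟨(i, j), Finset.mem_univ _, h.symm⟩)
  have h1 : JoinedIn chartSet (fun i => similarity (p i) (q i))
      fun i => similarity (i : ℕ) (s * (i : ℕ)) := by
    refine JoinedIn.ofLine (f := fun t i => similarity ((1 - t) * p i + t * (i : ℕ))
      ((1 - t) * q i + t * (s * (i : ℕ)))) ?_ (by simp) (by simp) ?_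
    · exact (continuous_pi fun i => continuous_similarity.comp
        (f := fun t : ℝ => ((1 - t) * p i + t * (i : ℕ), (1 - t) * q i + t * (s * (i : ℕ))))
        (by fun_prop)).continuousOn
    · rintro _ ⟨t, -, rfl⟩ i j hij hi hj
      rw [det_similarity_sub]
      intro h
      have hx : (1 - t) * (p i - p j) + t * ((i : ℕ) - (j : ℕ)) = 0 := by
        have := sq_nonneg ((1 - t) * q i + t * (s * (i : ℕ)) - ((1 - t) * q j + t * (s * (j : ℕ))))
        refine pow_eq_zero_iff two_ne_zero |>.1 (le_antisymm ?_ (sq_nonneg _))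
        linarith
      have hy : (1 - t) * (q i - q j) + t * s * ((i : ℕ) - (j : ℕ)) = 0 := by
        rw [show (1 - t) * p i + t * (i : ℕ) - ((1 - t) * p j + t * (j : ℕ)) = 0 by linarith] at h
        refine pow_eq_zero_iff two_ne_zero |>.1 ?_
        linarith
      have hij' : ((i : ℕ) : ℝ) - (j : ℕ) ≠ 0 := by
        rw [sub_ne_zero, Ne, Nat.cast_inj]
        exact Fin.val_ne_of_ne hij
      have hmem := hpq.target_mem i j hij hi hj
      rw [det_similarity_sub] at hmem
      rcases eq_or_ne t 0 with rfl | ht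
      · simp only [sub_zero, one_mul, zero_mul, add_zero] at hx hy
        simp [hx, hy] at hmem
      · have hp : (1 - t) * (p i - p j) ≠ 0 := fun h0 => by
          rw [h0, zero_add] at hx
          exact mul_ne_zero ht hij' hx
        refine hs' i j ((eq_div_iff (right_ne_zero_of_mul hp)).2 ?_)
        refine mul_left_cancel₀ (left_ne_zero_of_mul hp) ?_
        linear_combination s * hx - hy
  have h2 : JoinedIn chartSet (fun i => similarity (i : ℕ) (s * (i : ℕ)))
      fun i => similarity (i : ℕ) 0 := by
    refine JoinedIn.ofLine (f := fun t i => similarity (i : ℕ) ((1 - t) * (s * (i : ℕ)))) ?_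
      (by simp) (by simp) ?_
    · exact (continuous_pi fun i : Fin 5 => continuous_similarity.comp
        (f := fun t : ℝ => (((i : ℕ) : ℝ), (1 - t) * (s * (i : ℕ)))) (by fun_prop)).continuousOn
    · rintro _ ⟨t, -, rfl⟩ i j hij hi hj
      rw [det_similarity_sub]
      have hij' : ((i : ℕ) : ℝ) - (j : ℕ) ≠ 0 := by
        rw [sub_ne_zero, Ne, Nat.cast_inj]
        exact Fin.val_ne_of_ne hij
      positivity
  exact (hpq.trans h1).trans h2

lemma joinedIn_of_det_pos {A B : Fin 5 → Matrix (Fin 2) (Fin 2) ℝ}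
    (hA : ∀ i j, i < j → j < 4 → 0 < (A i - A j).det)
    (hB : ∀ i j, i < j → j < 4 → 0 < (B i - B j).det) : JoinedIn chartSet A B :=
  (joinedIn_scalar_of_det_pos hA).trans (joinedIn_scalar_of_det_pos hB).symm

lemma joinedIn_of_det_neg {A B : Fin 5 → Matrix (Fin 2) (Fin 2) ℝ}
    (hA : ∀ i j, i < j → j < 4 → (A i - A j).det < 0)
    (hB : ∀ i j, i < j → j < 4 → (B i - B j).det < 0) : JoinedIn chartSet A B := by
  let J : Matrix (Fin 2) (Fin 2) ℝ := !![1, 0; 0, -1]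
  have hJ : J.det = -1 := by simp [J, Matrix.det_fin_two]
  have hJJ : J * J = 1 := by
    ext i j
    fin_cases i <;> fin_cases j <;> simp [J]
  have hpos : ∀ C : Fin 5 → Matrix (Fin 2) (Fin 2) ℝ,
      (∀ i j, i < j → j < 4 → (C i - C j).det < 0) →
      ∀ i j, i < j → j < 4 → 0 < (C i * J - C j * J).det := fun C hC i j hij hj => by
    rw [← sub_mul, Matrix.det_mul, hJ]
    linarith [hC i j hij hj]
  have h := (joinedIn_of_det_pos (hpos A hA) (hpos B hB)).map
    (f := fun C i => C i * J) (by fun_prop)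
  simp only [mul_assoc, hJJ, mul_one] at h
  refine h.mono ?_
  rintro _ ⟨C, hC, rfl⟩
  simpa using mul_mul_mem_chartSet hC (g := 1) (by simp) (h := J) (by simp [hJ])

lemma exists_diagonalization {M : Matrix (Fin 2) (Fin 2) ℝ} (hM : M.det < 0) :
    ∃ (P : Matrix (Fin 2) (Fin 2) ℝ) (a b : ℝ), 0 < P.det ∧ 0 < a ∧ 0 < b ∧
      M * P = P * !![a, 0; 0, -b] := by
  set T := M 0 0 + M 1 1 with hT
  have hdet : M.det = M 0 0 * M 1 1 - M 0 1 * M 1 0 := Matrix.det_fin_two M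
  set r := √(T ^ 2 - 4 * M.det) with hr
  have hr2 : r ^ 2 = T ^ 2 - 4 * M.det := Real.sq_sqrt (by nlinarith [sq_nonneg T])
  have hrT : |T| < r := abs_lt_of_sq_lt_sq (by linarith) (Real.sqrt_nonneg _)
  obtain ⟨hrT1, hrT2⟩ := abs_lt.1 hrT
  set a := (r + T) / 2 with ha
  set b := (r - T) / 2 with hb
  have ha0 : 0 < a := by linarith
  have hb0 : 0 < b := by linarith
  have hdet' : ∀ c : ℝ, c ^ 2 - T * c + M.det = 0 →
      ∃ v : Fin 2 → ℝ, v ≠ 0 ∧ M 0 0 * v 0 + M 0 1 * v 1 = c * v 0 ∧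
        M 1 0 * v 0 + M 1 1 * v 1 = c * v 1 := fun c hc => by
    have h0 : (M - c • (1 : Matrix (Fin 2) (Fin 2) ℝ)).det = 0 := by
      rw [← hc, hdet]
      simp [Matrix.det_fin_two, hT]
      ring
    obtain ⟨v, hv, hMv⟩ := Matrix.exists_mulVec_eq_zero_iff.2 h0
    rw [Matrix.sub_mulVec, Matrix.smul_mulVec, Matrix.one_mulVec, sub_eq_zero] at hMv
    have e0 := congrFun hMv 0
    have e1 := congrFun hMv 1
    simp [Matrix.mulVec, dotProduct, Fin.sum_univ_two] at e0 e1
    exact ⟨v, hv, e0, e1⟩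
  obtain ⟨v, hv, v0, v1⟩ := hdet' a (by rw [ha]; linarith)
  obtain ⟨w, hw, w0, w1⟩ := hdet' (-b) (by rw [hb]; linarith)
  have hind : v 0 * w 1 - w 0 * v 1 ≠ 0 := fun h => by
    have hab : a + b ≠ 0 := by positivity
    have k0 : v 0 * w 0 = 0 := by
      refine (mul_eq_zero_iff_left hab).1 ?_
      linear_combination w 0 * -v0 + v 0 * w0 - M 0 1 * h
    have k1 : v 1 * w 1 = 0 := by
      refine (mul_eq_zero_iff_left hab).1 ?_
      linear_combination w 1 * -v1 + v 1 * w1 + M 1 0 * h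
    have hv' : v 0 ≠ 0 ∨ v 1 ≠ 0 := by
      by_contra! h
      exact hv (by ext i; fin_cases i <;> simp [h])
    refine hw ?_
    rcases hv' with hv' | hv'
    · have q0 : w 0 = 0 := by simpa [hv'] using k0
      have q1 : w 1 = 0 := by simpa [q0, hv'] using h
      ext i; fin_cases i <;> simp [q0, q1]
    · have q1 : w 1 = 0 := by simpa [hv'] using k1
      have q0 : w 0 = 0 := by simpa [q1, hv'] using h
      ext i; fin_cases i <;> simp [q0, q1]
  rcases lt_or_gt_of_ne hind with hneg | hpos
  · refine ⟨!![v 0, -w 0; v 1, -w 1], a, b, ?_, ha0, hb0, ?_⟩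
    · rw [Matrix.det_fin_two_of]
      linarith
    · ext i j
      fin_cases i <;> fin_cases j <;> simp [Matrix.mul_apply, Fin.sum_univ_two] <;> linarith
  · refine ⟨!![v 0, w 0; v 1, w 1], a, b, ?_, ha0, hb0, ?_⟩
    · rw [Matrix.det_fin_two_of]
      linarith
    · ext i j
      fin_cases i <;> fin_cases j <;> simp [Matrix.mul_apply, Fin.sum_univ_two] <;> linarith

/-- The normal form of four matrices: zero, the identity, a diagonal matrix, and a matrix. -/
def normalForm (a b x y κ μ : ℝ) : Fin 5 → Matrix (Fin 2) (Fin 2) ℝ :=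
  ![0, 1, !![a, 0; 0, -b], !![x, κ; μ, y], 0]

lemma det_normalForm_sub (a b x y κ μ : ℝ) :
    (normalForm a b x y κ μ 0 - normalForm a b x y κ μ 1).det = 1 ∧
    (normalForm a b x y κ μ 0 - normalForm a b x y κ μ 2).det = -(a * b) ∧
    (normalForm a b x y κ μ 0 - normalForm a b x y κ μ 3).det = x * y - κ * μ ∧
    (normalForm a b x y κ μ 1 - normalForm a b x y κ μ 2).det = (1 - a) * (1 + b) ∧
    (normalForm a b x y κ μ 1 - normalForm a b x y κ μ 3).det = x * y - κ * μ - x - y + 1 ∧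
    (normalForm a b x y κ μ 2 - normalForm a b x y κ μ 3).det =
      x * y - κ * μ - a * y + b * x - a * b := by
  refine ⟨?_, ?_, ?_, ?_, ?_, ?_⟩ <;> simp [normalForm, Matrix.det_fin_two] <;> ring

lemma forall_pairs_lt_four {p : Fin 5 → Fin 5 → Prop} (h01 : p 0 1) (h02 : p 0 2) (h03 : p 0 3)
    (h12 : p 1 2) (h13 : p 1 3) (h23 : p 2 3) : ∀ i j, i < j → j < 4 → p i j := by
  intro i j hij hj
  fin_cases j <;> fin_cases i <;> first | assumption | exact absurd hij (by decide) |
    exact absurd hj (by decide)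

lemma normalForm_mem_iff {a b : ℝ} (ha : 0 < a) (hb : 0 < b) (x y κ μ : ℝ) :
    normalForm a b x y κ μ ∈ chartSet ↔ x * y - κ * μ ≠ 0 ∧ 1 - a ≠ 0 ∧
      x * y - κ * μ - x - y + 1 ≠ 0 ∧ x * y - κ * μ - a * y + b * x - a * b ≠ 0 := by
  obtain ⟨h01, h02, h03, h12, h13, h23⟩ := det_normalForm_sub a b x y κ μ
  rw [mem_chartSet_iff]
  constructor
  · intro h
    refine ⟨h03 ▸ h 0 3 (by decide) (by decide), ?_, h13 ▸ h 1 3 (by decide) (by decide),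
      h23 ▸ h 2 3 (by decide) (by decide)⟩
    exact left_ne_zero_of_mul (h12 ▸ h 1 2 (by decide) (by decide))
  · rintro ⟨k03, k12, k13, k23⟩
    refine forall_pairs_lt_four ?_ ?_ ?_ ?_ ?_ ?_
    · rw [h01]
      exact one_ne_zero
    · rw [h02]
      exact neg_ne_zero.2 (mul_pos ha hb).ne'
    · rwa [h03]
    · rw [h12]
      exact mul_ne_zero k12 (by positivity)
    · rwa [h13]
    · rwa [h23]

lemma continuousOn_fin_two {p q r s : ℝ → ℝ} {I : Set ℝ} (hp : ContinuousOn p I)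
    (hq : ContinuousOn q I) (hr : ContinuousOn r I) (hs : ContinuousOn s I) :
    ContinuousOn (fun t => !![p t, q t; r t, s t]) I := by
  refine continuousOn_pi.2 fun j => continuousOn_pi.2 fun k => ?_
  fin_cases j <;> fin_cases k
  exacts [hp, hq, hr, hs]

lemma continuousOn_normalForm {a b x y κ μ : ℝ → ℝ} {s : Set ℝ} (ha : ContinuousOn a s)
    (hb : ContinuousOn b s) (hx : ContinuousOn x s) (hy : ContinuousOn y s)
    (hκ : ContinuousOn κ s) (hμ : ContinuousOn μ s) :
    ContinuousOn (fun t => normalForm (a t) (b t) (x t) (y t) (κ t) (μ t)) s := by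
  refine continuousOn_pi.2 fun i => ?_
  fin_cases i
  · exact continuousOn_const
  · exact continuousOn_const
  · exact continuousOn_fin_two ha continuousOn_const continuousOn_const hb.neg
  · exact continuousOn_fin_two hx hκ hμ hy
  · exact continuousOn_const

/-- The reflection of a matrix through the rotation by a half turn of the second and fourth
coordinates. -/
def flipMatrix (A : Matrix (Fin 2) (Fin 2) ℝ) : Matrix (Fin 2) (Fin 2) ℝ :=
  !![A 0 0, -A 0 1; -A 1 0, A 1 1]

lemma planeRotation_pi (v : V4) : planeRotation Real.pi v = ![v 0, -v 1, v 2, -v 3] := by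
  simp [planeRotation]

lemma frameJoined_flipMatrix {A : Fin 5 → Matrix (Fin 2) (Fin 2) ℝ} (hA : A ∈ chartSet) :
    FrameJoined (chartLines A) (chartLines fun i => flipMatrix (A i)) := by
  have hg : coeffDet ![1, 0, 0, -1] ≠ 0 := by simp [coeffDet]
  have hflip : ∀ i, reframe ![1, 0, 0, -1] (chartFrames (fun i => flipMatrix (A i)) i) =
      (planeRotation Real.pi (chartFrames A i).1, planeRotation Real.pi (chartFrames A i).2) := by
    intro i
    simp only [planeRotation_pi]
    by_cases hi : i = 4
    · simp only [chartFrames, if_pos hi]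
      refine Prod.ext ?_ ?_ <;> ext k <;> fin_cases k <;> simp [reframe]
    · simp only [chartFrames, if_neg hi]
      refine Prod.ext ?_ ?_ <;> ext k <;> fin_cases k <;> simp [reframe, graphFrame, flipMatrix]
  have hlines : (linesOf fun i => (planeRotation Real.pi (chartFrames A i).1,
      planeRotation Real.pi (chartFrames A i).2)) = chartLines fun i => flipMatrix (A i) :=
    funext fun i => (congrArg lineOf (hflip i)).symm.trans (lineOf_reframe hg _)
  rw [← hlines]
  exact frameJoined_of_joinedIn
    (joinedIn_planeRotation ((chartFrames_mem_iff A).2 hA) Real.pi)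

lemma exists_frameJoined_normalForm_pos {a b : ℝ} (ha : 0 < a) (hb : 0 < b) {x y κ μ : ℝ}
    (h : normalForm a b x y κ μ ∈ chartSet) :
    ∃ κ' μ', 0 < κ' ∧ normalForm a b x y κ' μ' ∈ chartSet ∧
      FrameJoined (chartLines (normalForm a b x y κ μ))
        (chartLines (normalForm a b x y κ' μ')) := by
  rcases lt_trichotomy κ 0 with hκ | rfl | hκ
  · have hflip : (fun i => flipMatrix (normalForm a b x y κ μ i)) =
        normalForm a b x y (-κ) (-μ) := by
      have h0 : flipMatrix 0 = 0 := by
        ext j k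
        fin_cases j <;> fin_cases k <;> simp [flipMatrix]
      have h1 : flipMatrix 1 = 1 := by
        ext j k
        fin_cases j <;> fin_cases k <;> simp [flipMatrix]
      funext i
      fin_cases i
      · exact h0
      · exact h1
      · change flipMatrix !![a, 0; 0, -b] = !![a, 0; 0, -b]
        simp [flipMatrix]
      · rfl
      · exact h0
    refine ⟨-κ, -μ, neg_pos.2 hκ, ?_, hflip ▸ frameJoined_flipMatrix h⟩
    rw [normalForm_mem_iff ha hb] at h ⊢
    rwa [neg_mul_neg]
  · have hmem : ∀ κ' μ' : ℝ, κ' * μ' = 0 → normalForm a b x y κ' μ' ∈ chartSet := by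
      intro κ' μ' h'
      rw [normalForm_mem_iff ha hb] at h ⊢
      simpa only [h', zero_mul] using h
    refine ⟨1, 0, one_pos, hmem 1 0 (by simp), frameJoined_of_joinedIn_chartSet ?_⟩
    have h1 : JoinedIn chartSet (normalForm a b x y 0 μ) (normalForm a b x y 0 0) := by
      refine JoinedIn.ofLine (f := fun t => normalForm a b x y 0 ((1 - t) * μ)) ?_ (by simp)
        (by simp) ?_
      · apply continuousOn_normalForm <;> fun_prop
      · rintro _ ⟨t, -, rfl⟩
        exact hmem _ _ (zero_mul _)
    refine h1.trans ?_
    refine JoinedIn.ofLine (f := fun t => normalForm a b x y t 0) ?_ (by simp) (by simp) ?_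
    · apply continuousOn_normalForm <;> fun_prop
    · rintro _ ⟨t, -, rfl⟩
      exact hmem _ _ (mul_zero _)
  · exact ⟨κ, μ, hκ, h, FrameJoined.refl ((pairwiseSkew_linesOf_iff _).2
      ((chartFrames_mem_iff _).2 h))⟩

lemma exists_frameJoined_normalForm {A : Fin 5 → Matrix (Fin 2) (Fin 2) ℝ} (hA : A ∈ chartSet)
    (h01 : 0 < (A 0 - A 1).det) (h02 : (A 0 - A 2).det < 0) :
    ∃ a b x y κ μ, 0 < a ∧ 0 < b ∧ 0 < κ ∧ normalForm a b x y κ μ ∈ chartSet ∧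
      FrameJoined (chartLines A) (chartLines (normalForm a b x y κ μ)) := by
  set C := A 1 - A 0 with hC
  have hCdet : 0 < C.det := by rwa [hC, det_sub_comm]
  have hCinv : 0 < C⁻¹.det := by
    rw [Matrix.det_nonsing_inv, Ring.inverse_eq_inv']
    exact inv_pos.2 hCdet
  have hCC : C⁻¹ * C = 1 := Matrix.nonsing_inv_mul _ hCdet.ne'.isUnit
  obtain ⟨P, a, b, hP, ha, hb, hPD⟩ := exists_diagonalization (M := C⁻¹ * (A 2 - A 0)) (by
    rw [Matrix.det_mul, det_sub_comm (A 2)]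
    exact mul_neg_of_pos_of_neg hCinv h02)
  have hPinv : 0 < P⁻¹.det := by
    rw [Matrix.det_nonsing_inv, Ring.inverse_eq_inv']
    exact inv_pos.2 hP
  have hPP : P⁻¹ * P = 1 := Matrix.nonsing_inv_mul _ hP.ne'.isUnit
  have hsub := joinedIn_sub hA (A 0)
  have hmul := joinedIn_mul_mul hsub.target_mem (g := P⁻¹ * C⁻¹) (h := P)
    (by rw [Matrix.det_mul]; exact mul_pos hPinv hCinv) hP
  set X := P⁻¹ * C⁻¹ * (A 3 - A 0) * P with hX
  have hnormal := joinedIn_of_forall_ne_four hmul.target_mem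
    (B := normalForm a b (X 0 0) (X 1 1) (X 0 1) (X 1 0)) fun i hi => by
      fin_cases i
      · simp [normalForm]
      · change P⁻¹ * C⁻¹ * C * P = 1
        rw [mul_assoc P⁻¹, hCC, mul_one, hPP]
      · change P⁻¹ * C⁻¹ * (A 2 - A 0) * P = !![a, 0; 0, -b]
        rw [mul_assoc P⁻¹, mul_assoc P⁻¹, hPD, ← mul_assoc, hPP, one_mul]
      · change X = !![X 0 0, X 0 1; X 1 0, X 1 1]
        exact Matrix.eta_fin_two X
      · exact absurd rfl hi
  obtain ⟨κ, μ, hκ, hmem, hjoin⟩ := exists_frameJoined_normalForm_pos ha hb hnormal.target_mem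
  exact ⟨a, b, _, _, κ, μ, ha, hb, hκ, hmem,
    (frameJoined_of_joinedIn_chartSet ((hsub.trans hmul).trans hnormal)).trans hjoin⟩

lemma lerp_ne_zero {u v t : ℝ} (h : 0 < u * v) (ht : t ∈ Set.Icc (0 : ℝ) 1) :
    (1 - t) * u + t * v ≠ 0 := by
  obtain ⟨h0, h1⟩ := ht
  intro h'
  have e : (1 - t) * u ^ 2 + t * (u * v) = 0 := by linear_combination u * h'
  have e' : (1 - t) * (u * v) + t * v ^ 2 = 0 := by linear_combination v * h'
  nlinarith [mul_nonneg (sub_nonneg.2 h1) (sq_nonneg u), mul_nonneg h0 (sq_nonneg v),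
    mul_nonneg h0 h.le, mul_nonneg (sub_nonneg.2 h1) h.le]

lemma lerp_pos {u v t : ℝ} (hu : 0 < u) (hv : 0 < v) (ht : t ∈ Set.Icc (0 : ℝ) 1) :
    0 < (1 - t) * u + t * v := by
  have := lerp_ne_zero (mul_pos hu hv) ht
  refine lt_of_le_of_ne ?_ this.symm
  exact add_nonneg (mul_nonneg (sub_nonneg.2 ht.2) hu.le) (mul_nonneg ht.1 hv.le)

lemma mul_pos_of_sign_eq {u v : ℝ} (hu : u ≠ 0) (hv : v ≠ 0) (h : Real.sign u = Real.sign v) :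
    0 < u * v := by
  rcases lt_or_gt_of_ne hu with hu | hu <;> rcases lt_or_gt_of_ne hv with hv | hv
  · exact mul_pos_of_neg_of_neg hu hv
  · rw [Real.sign_of_neg hu, Real.sign_of_pos hv] at h
    norm_num at h
  · rw [Real.sign_of_pos hu, Real.sign_of_neg hv] at h
    norm_num at h
  · exact mul_pos hu hv

/-- The normal form with prescribed determinants of differences. -/
noncomputable def invariantForm (a b D n m κ : ℝ) : Fin 5 → Matrix (Fin 2) (Fin 2) ℝ :=
  let x := (m - D + a * b + a * (D + 1 - n)) / (a + b)
  let y := (b * (D + 1 - n) - (m - D + a * b)) / (a + b)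
  normalForm a b x y κ ((x * y - D) / κ)

lemma normalForm_eq_invariantForm {a b κ : ℝ} (ha : 0 < a) (hb : 0 < b) (hκ : 0 < κ)
    (x y μ : ℝ) : normalForm a b x y κ μ =
      invariantForm a b (x * y - κ * μ) (x * y - κ * μ - x - y + 1)
        (x * y - κ * μ - a * y + b * x - a * b) κ := by
  have hab : a + b ≠ 0 := by positivity
  rw [invariantForm]
  have hx : (x * y - κ * μ - a * y + b * x - a * b - (x * y - κ * μ) + a * b +
      a * (x * y - κ * μ + 1 - (x * y - κ * μ - x - y + 1))) / (a + b) = x := by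
    field_simp
    ring
  have hy : (b * (x * y - κ * μ + 1 - (x * y - κ * μ - x - y + 1)) -
      (x * y - κ * μ - a * y + b * x - a * b - (x * y - κ * μ) + a * b)) / (a + b) = y := by
    field_simp
    ring
  simp only [hx, hy]
  congr 1
  field_simp
  ring

lemma invariantForm_mem_iff {a b κ : ℝ} (ha : 0 < a) (hb : 0 < b) (hκ : 0 < κ) (D n m : ℝ) :
    invariantForm a b D n m κ ∈ chartSet ↔ D ≠ 0 ∧ 1 - a ≠ 0 ∧ n ≠ 0 ∧ m ≠ 0 := by
  have hab : a + b ≠ 0 := by positivity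
  rw [invariantForm, normalForm_mem_iff ha hb, mul_div_cancel₀ _ hκ.ne', sub_sub_cancel]
  have hn : D - (m - D + a * b + a * (D + 1 - n)) / (a + b) -
      (b * (D + 1 - n) - (m - D + a * b)) / (a + b) + 1 = n := by
    field_simp
    ring
  have hm : D - a * ((b * (D + 1 - n) - (m - D + a * b)) / (a + b)) +
      b * ((m - D + a * b + a * (D + 1 - n)) / (a + b)) - a * b = m := by
    field_simp
    ring
  rw [hn, hm]

lemma joinedIn_invariantForm {a b D n m κ a' b' D' n' m' κ' : ℝ} (ha : 0 < a) (hb : 0 < b)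
    (hκ : 0 < κ) (ha' : 0 < a') (hb' : 0 < b') (hκ' : 0 < κ') (hD : 0 < D * D')
    (h1a : 0 < (1 - a) * (1 - a')) (hn : 0 < n * n') (hm : 0 < m * m') :
    JoinedIn chartSet (invariantForm a b D n m κ) (invariantForm a' b' D' n' m' κ') := by
  refine JoinedIn.ofLine (f := fun t => invariantForm ((1 - t) * a + t * a')
    ((1 - t) * b + t * b') ((1 - t) * D + t * D') ((1 - t) * n + t * n')
    ((1 - t) * m + t * m') ((1 - t) * κ + t * κ')) ?_ (by simp) (by simp) ?_
  · have hab : ∀ t ∈ unitInterval, (1 - t) * a + t * a' + ((1 - t) * b + t * b') ≠ 0 :=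
      fun t ht => (add_pos (lerp_pos ha ha' ht) (lerp_pos hb hb' ht)).ne'
    have hk : ∀ t ∈ unitInterval, (1 - t) * κ + t * κ' ≠ 0 :=
      fun t ht => (lerp_pos hκ hκ' ht).ne'
    refine continuousOn_normalForm (by fun_prop) (by fun_prop) ?_ ?_ (by fun_prop) ?_
    · exact ContinuousOn.div (by fun_prop) (by fun_prop) hab
    · exact ContinuousOn.div (by fun_prop) (by fun_prop) hab
    · exact ContinuousOn.div (ContinuousOn.sub (ContinuousOn.mul
        (ContinuousOn.div (by fun_prop) (by fun_prop) hab)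
        (ContinuousOn.div (by fun_prop) (by fun_prop) hab)) (by fun_prop)) (by fun_prop) hk
  · rintro _ ⟨t, ht, rfl⟩
    rw [invariantForm_mem_iff (lerp_pos ha ha' ht) (lerp_pos hb hb' ht) (lerp_pos hκ hκ' ht)]
    refine ⟨lerp_ne_zero hD ht, ?_, lerp_ne_zero hn ht, lerp_ne_zero hm ht⟩
    have := lerp_ne_zero h1a ht
    intro h
    exact this (by linear_combination h)

lemma frameJoined_normalForm {a b x y κ μ a' b' x' y' κ' μ' : ℝ} (ha : 0 < a) (hb : 0 < b)
    (hκ : 0 < κ) (ha' : 0 < a') (hb' : 0 < b') (hκ' : 0 < κ')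
    (hmem : normalForm a b x y κ μ ∈ chartSet) (hmem' : normalForm a' b' x' y' κ' μ' ∈ chartSet)
    (h : ∀ i j, i < j → j < 4 →
      Real.sign (normalForm a b x y κ μ i - normalForm a b x y κ μ j).det =
        Real.sign (normalForm a' b' x' y' κ' μ' i - normalForm a' b' x' y' κ' μ' j).det) :
    FrameJoined (chartLines (normalForm a b x y κ μ))
      (chartLines (normalForm a' b' x' y' κ' μ')) := by
  have hpos : ∀ i j, i < j → j < 4 → 0 < (normalForm a b x y κ μ i -
      normalForm a b x y κ μ j).det *
        (normalForm a' b' x' y' κ' μ' i - normalForm a' b' x' y' κ' μ' j).det :=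
    fun i j hij hj => mul_pos_of_sign_eq ((mem_chartSet_iff _).1 hmem i j hij hj)
      ((mem_chartSet_iff _).1 hmem' i j hij hj) (h i j hij hj)
  obtain ⟨-, -, h03, h12, h13, h23⟩ := det_normalForm_sub a b x y κ μ
  obtain ⟨-, -, h03', h12', h13', h23'⟩ := det_normalForm_sub a' b' x' y' κ' μ'
  have p03 := hpos 0 3 (by decide) (by decide)
  have p12 := hpos 1 2 (by decide) (by decide)
  have p13 := hpos 1 3 (by decide) (by decide)
  have p23 := hpos 2 3 (by decide) (by decide)
  rw [h03, h03'] at p03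
  rw [h12, h12'] at p12
  rw [h13, h13'] at p13
  rw [h23, h23'] at p23
  refine frameJoined_of_joinedIn_chartSet ?_
  rw [normalForm_eq_invariantForm ha hb hκ, normalForm_eq_invariantForm ha' hb' hκ']
  refine joinedIn_invariantForm ha hb hκ ha' hb' hκ' p03 ?_ p13 p23
  have hbb : 0 < (1 + b) * (1 + b') := by positivity
  refine (pos_iff_pos_of_mul_pos ?_).2 hbb
  linarith

lemma standardEdges_cases (m : ℕ) :
    ((0, 1) ∈ standardEdges m ∧ (0, 2) ∉ standardEdges m) ∨
      (∀ i j : Fin 5, i < j → j < 4 → (i, j) ∈ standardEdges m) ∨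
      ∀ i j : Fin 5, i < j → j < 4 → (i, j) ∉ standardEdges m := by
  unfold standardEdges
  split
  · simp
  all_goals first
    | exact Or.inl ⟨by decide, by decide⟩
    | exact Or.inr (Or.inl (forall_pairs_lt_four (by decide) (by decide) (by decide) (by decide)
        (by decide) (by decide)))

lemma pos_iff_of_sign_eq_boolSign {a : ℝ} (ha : a ≠ 0) {b : Bool}
    (h : Real.sign a = boolSign b) : 0 < a ↔ b = true := by
  rw [sign_eq_boolSign ha] at h
  cases b <;> by_cases h0 : 0 < a <;> simp [h0, boolSign] at h ⊢ <;> norm_num at h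

lemma frameJoined_chartLines {A B : Fin 5 → Matrix (Fin 2) (Fin 2) ℝ} (hA : A ∈ chartSet)
    (hB : B ∈ chartSet) (m : ℕ) (hAe : HasEdges (chartLines A) (standardEdges m))
    (hBe : HasEdges (chartLines B) (standardEdges m)) :
    FrameJoined (chartLines A) (chartLines B) := by
  have hpos : ∀ C ∈ chartSet, HasEdges (chartLines C) (standardEdges m) → ∀ i j, i < j → j < 4 →
      (0 < (C i - C j).det ↔ (i, j) ∈ standardEdges m) := fun C hC hCe i j hij hj => by
    have h := hCe i j hij hj
    rw [lk_chartLines hC hij hj] at h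
    rw [pos_iff_of_sign_eq_boolSign ((mem_chartSet_iff C).1 hC i j hij hj) h, decide_eq_true_iff]
  have hneg : ∀ C ∈ chartSet, HasEdges (chartLines C) (standardEdges m) → ∀ i j, i < j → j < 4 →
      (i, j) ∉ standardEdges m → (C i - C j).det < 0 := fun C hC hCe i j hij hj h =>
    lt_of_le_of_ne (not_lt.1 fun h' => h ((hpos C hC hCe i j hij hj).1 h'))
      ((mem_chartSet_iff C).1 hC i j hij hj)
  rcases standardEdges_cases m with ⟨h01, h02⟩ | h | h
  · have hnormal : ∀ C ∈ chartSet, HasEdges (chartLines C) (standardEdges m) → _ :=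
      fun C hC hCe => exists_frameJoined_normalForm hC
        ((hpos C hC hCe 0 1 (by decide) (by decide)).2 h01)
        (hneg C hC hCe 0 2 (by decide) (by decide) h02)
    obtain ⟨a, b, x, y, κ, μ, ha, hb, hκ, hmem, hj⟩ := hnormal A hA hAe
    obtain ⟨a', b', x', y', κ', μ', ha', hb', hκ', hmem', hj'⟩ := hnormal B hB hBe
    refine (hj.trans (frameJoined_normalForm ha hb hκ ha' hb' hκ' hmem hmem'
      fun i j hij hj4 => ?_)).trans hj'.symm
    have hi4 := (hij.trans hj4).ne
    rw [← lk_chartLines hmem hij hj4, ← lk_chartLines hmem' hij hj4,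
      ← hj.deformation.lk_eq hij.ne hi4 hj4.ne, ← hj'.deformation.lk_eq hij.ne hi4 hj4.ne,
      hAe i j hij hj4, hBe i j hij hj4]
  · exact frameJoined_of_joinedIn_chartSet (joinedIn_of_det_pos
      (fun i j hij hj => (hpos A hA hAe i j hij hj).2 (h i j hij hj))
      fun i j hij hj => (hpos B hB hBe i j hij hj).2 (h i j hij hj))
  · exact frameJoined_of_joinedIn_chartSet (joinedIn_of_det_neg
      (fun i j hij hj => hneg A hA hAe i j hij hj (h i j hij hj))
      fun i j hij hj => hneg B hB hBe i j hij hj (h i j hij hj))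

lemma HasEdges.of_frameJoined {L L' : Fin 5 → PLine} {l : List (Fin 5 × Fin 5)}
    (h : HasEdges L l) (hLL' : FrameJoined L L') : HasEdges L' l := fun i j hij hj => by
  rw [← hLL'.deformation.lk_eq hij.ne (hij.trans hj).ne hj.ne, h i j hij hj]

lemma frameJoined_of_hasEdges {L L' : Fin 5 → PLine} (hL : PairwiseSkew L)
    (hL' : PairwiseSkew L') (m : ℕ) (h : HasEdges L (standardEdges m))
    (h' : HasEdges L' (standardEdges m)) : FrameJoined L L' := by
  obtain ⟨A, hA, hLA⟩ := exists_frameJoined_chartLines hL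
  obtain ⟨B, hB, hLB⟩ := exists_frameJoined_chartLines hL'
  exact (hLA.trans (frameJoined_chartLines hA hB m (h.of_frameJoined hLA)
    (h'.of_frameJoined hLB))).trans hLB.symm

theorem viro_signature_complete_five (L L' : Fin 5 → PLine)
    (hL : PairwiseSkew L) (hL' : PairwiseSkew L') :
    DeformEquiv L L' ↔ sgnOf L = sgnOf L' := by
  refine ⟨fun h => DeformEquiv.sgnOf_eq hL hL' h, fun h => ?_⟩
  obtain ⟨π, m, hm, hπ⟩ := hL.exists_perm_hasEdges
  obtain ⟨π', m', hm', hπ'⟩ := hL'.exists_perm_hasEdges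
  have hmm : m = m' := by
    rw [hm, hm'] at h
    have : (m : ℝ) = m' := by linarith
    exact_mod_cast this
  subst hmm
  exact ⟨π, π', (frameJoined_of_hasEdges (fun i j hij => hL _ _ (π.injective.ne hij))
    (fun i j hij => hL' _ _ (π'.injective.ne hij)) m hπ hπ').deformation⟩
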